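/- (Frequent Sequential Pattern Mining, Theorem 1.) Let SDB be a sequence database over an alphabet Σ, let ℓ be the maximal length of a sequence in SDB, let minsup be a natural number, and let p be a sequence over Σ with |p| ≤ ℓ. Then sup(p) ≥ minsup if and only if the number of sequences s ∈ SDB such that the word p · EOS^{ℓ−|p|} is accepted by the subsequence automaton A_s is at least minsup. (Equivalently, p is a frequent sequential pattern iff the constraints S_s = 1 ↔ Regular(p, A_s) for all s ∈ SDB together with Σ_s S_s ≥ minsup are satisfied by the padded assignment of p and the indicator values S_s.) -/

import Mathlib

/-- The padded word `p · EOS^(ℓ - |p|)` over `Σ ∪ {EOS}`, with `EOS` modelled as `none`. -/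
def padded {α : Type*} (p : List α) (ℓ : ℕ) : List (Option α) :=
  p.map some ++ List.replicate (ℓ - p.length) none

/-- The subsequence automaton `A_s` of a sequence `s = ⟨a_1,…,a_n⟩`: states `{0,…,n}`,
initial state `0`, unique accepting state `n`, a transition from `q` to `j` labeled `a_j`
for all `0 ≤ q < j ≤ n`, and a transition from every state `q` to `n` labeled `EOS`. -/
def subseqNFA {α : Type*} (s : List α) : NFA (Option α) (Fin (s.length + 1)) where
  step q a :=
    match a with
    | none => {Fin.last s.length}
    | some x => { j | ∃ h : (q : ℕ) < (j : ℕ),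
        s[(j : ℕ) - 1]'(by have := j.isLt; omega) = x }
  start := {0}
  accept := {Fin.last s.length}

open Classical in
/-- Number of sequences of the database `SDB` satisfying the property `P`. -/
noncomputable def countSat {α : Type*} (SDB : List (List α)) (P : List α → Prop) : ℕ :=
  SDB.countP fun s => decide (P s)

/-- The support `sup(p)` of `p`: the number of sequences of `SDB` containing `p`
as a subsequence. -/
noncomputable def support {α : Type*} (SDB : List (List α)) (p : List α) : ℕ :=
  countSat SDB fun s => p.Sublist s

theorem List.cons_sublist_drop_iff {α : Type*} {x : α} {p s : List α} {q : ℕ} :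
    (x :: p).Sublist (s.drop q) ↔
      ∃ (i : ℕ) (h : i < s.length), q ≤ i ∧ s[i] = x ∧ p.Sublist (s.drop (i + 1)) := by
  constructor
  · intro h
    obtain ⟨r₁, r₂, hr, hx, hp⟩ := List.cons_sublist_iff.1 h
    obtain ⟨i, hi, rfl⟩ := List.getElem_of_mem hx
    have hlen := congrArg List.length hr
    simp only [List.length_drop, List.length_append] at hlen
    refine ⟨q + i, by omega, by omega, ?_, ?_⟩
    · rw [← List.getElem_drop (h := by simp; omega)]
      simp only [hr]
      rw [List.getElem_append_left hi]
    · rw [add_assoc, ← List.drop_drop, hr, List.drop_append_of_le_length (by omega)]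
      exact hp.trans (List.sublist_append_right _ _)
  · rintro ⟨i, hi, hqi, rfl, hp⟩
    refine (hp.cons_cons s[i]).trans ?_
    rw [← List.drop_eq_getElem_cons]
    exact List.drop_sublist_drop_left _ hqi

theorem exists_mem_evalFrom_subseqNFA_iff {α : Type*} (s p : List α)
    (q : Fin (s.length + 1)) :
    (∃ j, j ∈ (subseqNFA s).evalFrom {q} (p.map some)) ↔ p.Sublist (s.drop q) := by
  induction p generalizing q with
  | nil => simp
  | cons x p ih =>
    rw [List.cons_sublist_drop_iff, List.map_cons]
    simp only [NFA.evalFrom_cons, NFA.stepSet_singleton]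
    simp only [NFA.mem_evalFrom_iff_exists (S := (subseqNFA s).step q (some x))]
    rw [exists_comm]
    simp only [exists_and_left, ih]
    constructor
    · rintro ⟨t, ⟨ht, hx⟩, hp⟩
      have hlt := t.isLt
      refine ⟨t - 1, by omega, by omega, hx, ?_⟩
      rwa [Nat.sub_add_cancel (by omega)]
    · rintro ⟨i, hqi, hi, hx, hp⟩
      exact ⟨⟨i + 1, by omega⟩, ⟨Nat.lt_succ_of_le hqi, hx⟩, hp⟩

theorem add_length_le_of_mem_evalFrom_subseqNFA {α : Type*} {s p : List α}
    {q j : Fin (s.length + 1)} (h : j ∈ (subseqNFA s).evalFrom {q} (p.map some)) :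
    (q : ℕ) + p.length ≤ j := by
  induction p generalizing q with
  | nil => simp_all
  | cons x p ih =>
    rw [List.map_cons, NFA.evalFrom_cons, NFA.stepSet_singleton,
      NFA.mem_evalFrom_iff_exists] at h
    obtain ⟨t, ⟨ht, -⟩, hj⟩ := h
    have := ih hj
    simp only [List.length_cons]
    omega

theorem last_mem_evalFrom_replicate_none_iff {α : Type*} (s : List α) (k : ℕ)
    (S : Set (Fin (s.length + 1))) :
    Fin.last s.length ∈ (subseqNFA s).evalFrom S (List.replicate (k + 1) none) ↔
      S.Nonempty := by
  induction k generalizing S with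
  | zero => simp [NFA.mem_stepSet, subseqNFA, Set.Nonempty]
  | succ k ih =>
    rw [List.replicate_succ, NFA.evalFrom_cons, ih]
    simp [Set.Nonempty, NFA.mem_stepSet, subseqNFA]

theorem padded_mem_accepts_subseqNFA_iff {α : Type*} {s p : List α} {ℓ : ℕ}
    (hs : s.length ≤ ℓ) (hp : p.length ≤ ℓ) :
    padded p ℓ ∈ (subseqNFA s).accepts ↔ p.Sublist s := by
  have key := exists_mem_evalFrom_subseqNFA_iff s p 0
  rw [Fin.val_zero, List.drop_zero] at key
  have hacc : padded p ℓ ∈ (subseqNFA s).accepts ↔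
      Fin.last s.length ∈ (subseqNFA s).evalFrom
        ((subseqNFA s).evalFrom {0} (p.map some)) (List.replicate (ℓ - p.length) none) := by
    rw [← NFA.evalFrom_append, NFA.mem_accepts]
    simp [subseqNFA, padded]
  rw [hacc, ← key]
  rcases h : ℓ - p.length with _ | k
  · rw [List.replicate_zero, NFA.evalFrom_nil]
    refine ⟨fun h => ⟨_, h⟩, ?_⟩
    rintro ⟨j, hj⟩
    have hle := add_length_le_of_mem_evalFrom_subseqNFA hj
    have hlt := j.isLt
    have : j = Fin.last s.length := Fin.ext (by simp at hle ⊢; omega)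
    exact this ▸ hj
  · exact last_mem_evalFrom_replicate_none_iff s k _


/-- Frequent Sequential Pattern Mining (Theorem 1): `sup(p) ≥ minsup` iff the number of
sequences `s ∈ SDB` whose subsequence automaton `A_s` accepts the padded word
`p · EOS^(ℓ-|p|)` is at least `minsup`. -/
theorem stmt3 {α : Type*} (SDB : List (List α)) (ℓ minsup : ℕ) (p : List α)
    (hℓ : ∀ s ∈ SDB, s.length ≤ ℓ) (hp : p.length ≤ ℓ) :
    minsup ≤ support SDB p ↔
      minsup ≤ countSat SDB (fun s => padded p ℓ ∈ (subseqNFA s).accepts) := by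
  have h : support SDB p =
      countSat SDB (fun s => padded p ℓ ∈ (subseqNFA s).accepts) :=
    List.countP_congr fun s hs => by
      simp [padded_mem_accepts_subseqNFA_iff (hℓ s hs) hp]
  rw [h]
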